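/- Consider a two-player extensive-form game (as in the model below) satisfying perfect recall that is triangle-free. Then every extreme point of the von Stengel–Forges polytope 𝒱 has all coordinates in {0, 1}. -/

import Mathlib

open scoped Classical

/-- The type of "sequences" of a player: `none` is the empty sequence `∅`, and
`some (I, a)` is the sequence consisting of information set `I` (a set of nodes)
together with action `a` at `I`. -/
abbrev SeqP := Option (Set (List ℕ) × ℕ)

/-- The type of (candidate) reduced-normal-form plans: partial functions from
information sets to actions, encoded with `Option`. -/
abbrev PlanT := Set (List ℕ) → Option ℕ

/-- Two information sets (of the two players) are connected, `I ⇌ J`, if some node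
of one is a prefix of some node of the other. -/
def Connected (I J : Set (List ℕ)) : Prop := ∃ u ∈ I, ∃ v ∈ J, u <+: v ∨ v <+: u

/-- A two-player extensive-form game.  Nodes are histories (finite lists of naturals),
`H` is the finite, prefix-closed set of nodes.  The two players are `0` and `1`
(as elements of `Fin 2`, embedded into `Fin 3` via `Fin.castSucc`), and an internal
node `u` with `owner u = 2` is a chance node.  `sim i` is the information-partition
equivalence relation of player `i` on the internal nodes owned by player `i`. -/
structure EFG where
  H : Finset (List ℕ)
  root_mem : ([] : List ℕ) ∈ H
  prefix_closed : ∀ u v : List ℕ, u <+: v → v ∈ H → u ∈ H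
  owner : List ℕ → Fin 3
  sim : Fin 2 → List ℕ → List ℕ → Prop
  sim_mem : ∀ i u v, sim i u v → (∃ a, u ++ [a] ∈ H) ∧ owner u = Fin.castSucc i
  sim_refl : ∀ i u, (∃ a, u ++ [a] ∈ H) → owner u = Fin.castSucc i → sim i u u
  sim_symm : ∀ i u v, sim i u v → sim i v u
  sim_trans : ∀ i u v w, sim i u v → sim i v w → sim i u w
  sim_actions : ∀ i u v, sim i u v → ∀ a : ℕ, u ++ [a] ∈ H ↔ v ++ [a] ∈ H

namespace EFG

variable (G : EFG)

/-- A node is internal if it has at least one child in the tree. -/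
def Internal (u : List ℕ) : Prop := ∃ a, u ++ [a] ∈ G.H

/-- The (finite) set of actions `A(u) = {a : u ++ [a] ∈ H}` available at node `u`. -/
noncomputable def actions (u : List ℕ) : Finset ℕ :=
  (G.H.finite_toSet.preimage (f := fun a : ℕ => u ++ [a])
    (fun a _ b _ hab => by simpa using hab)).toFinset

/-- `I` is an information set of player `i`: an equivalence class of `sim i`. -/
def InfoSet (i : Fin 2) (I : Set (List ℕ)) : Prop :=
  ∃ u, G.sim i u u ∧ I = {v | G.sim i u v}

/-- `seqᵢ(u)`: the list (ordered by increasing length of the prefix `w`) of pairs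
`(I, a)` such that `w ++ [a] ≼ u` for some internal node `w` owned by player `i`
whose information set is `I`. -/
noncomputable def playerSeq (i : Fin 2) (u : List ℕ) : List (Set (List ℕ) × ℕ) :=
  (List.range u.length).filterMap fun k =>
    if G.Internal (u.take k) ∧ G.owner (u.take k) = Fin.castSucc i then
      some ({v | G.sim i (u.take k) v}, u.getD k 0)
    else none

/-- Perfect recall: nodes in the same information set have the same player sequence. -/
def PerfectRecall : Prop := ∀ i u v, G.sim i u v → G.playerSeq i u = G.playerSeq i v

/-- The parent sequence `σ(I)` of an information set `I` of player `i`: the last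
element of `seqᵢ(u)` for `u ∈ I` (`none` encodes the empty sequence `∅`). -/
noncomputable def parentSeq (i : Fin 2) (I : Set (List ℕ)) : SeqP :=
  if h : ∃ u, u ∈ I then (G.playerSeq i h.choose).getLast? else none

/-- All chance moves are public: any two nodes in the same information set have
the same set of chance moves (pairs of a chance node and an action) on their paths. -/
def PublicChance : Prop :=
  ∀ i u v, G.sim i u v →
    {p : List ℕ × ℕ | G.Internal p.1 ∧ G.owner p.1 = 2 ∧ p.1 ++ [p.2] <+: u} =
    {p : List ℕ × ℕ | G.Internal p.1 ∧ G.owner p.1 = 2 ∧ p.1 ++ [p.2] <+: v}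

/-- Triangle-freeness of the game. -/
def TriangleFree : Prop :=
  ¬ ∃ I₁ I₂ J₁ J₂ : Set (List ℕ),
      G.InfoSet 0 I₁ ∧ G.InfoSet 0 I₂ ∧ G.InfoSet 1 J₁ ∧ G.InfoSet 1 J₂ ∧
      I₁ ≠ I₂ ∧ J₁ ≠ J₂ ∧
      G.parentSeq 0 I₁ = G.parentSeq 0 I₂ ∧ G.parentSeq 1 J₁ = G.parentSeq 1 J₂ ∧
      Connected I₁ J₁ ∧ Connected I₂ J₂ ∧ Connected I₁ J₂

/-- `σ` is a member of `Σᵢ`, the set of sequences of player `i`. -/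
def IsSeq (i : Fin 2) (σ : SeqP) : Prop :=
  σ = none ∨ ∃ I a, σ = some (I, a) ∧ G.InfoSet i I ∧ ∃ u ∈ I, u ++ [a] ∈ G.H

/-- `(σ₁, σ₂)` is a relevant sequence pair, `σ₁ ⇌ σ₂`. -/
def RelPair (σ₁ σ₂ : SeqP) : Prop :=
  G.IsSeq 0 σ₁ ∧ G.IsSeq 1 σ₂ ∧
    (σ₁ = none ∨ σ₂ = none ∨
      ∃ I₁ a₁ I₂ a₂, σ₁ = some (I₁, a₁) ∧ σ₂ = some (I₂, a₂) ∧ Connected I₁ I₂)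

/-- `σ₂ ∈ Σ₂` is relevant for the player-1 information set `I₁`. -/
def RelFor₁ (σ₂ : SeqP) (I₁ : Set (List ℕ)) : Prop :=
  σ₂ = none ∨ ∃ I₂ a₂, σ₂ = some (I₂, a₂) ∧ Connected I₁ I₂

/-- `σ₁ ∈ Σ₁` is relevant for the player-2 information set `I₂`. -/
def RelFor₂ (σ₁ : SeqP) (I₂ : Set (List ℕ)) : Prop :=
  σ₁ = none ∨ ∃ I₁ a₁, σ₁ = some (I₁, a₁) ∧ Connected I₁ I₂

/-- The index set of correlation plans: the relevant sequence pairs `Σ₁ ⇌ Σ₂`. -/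
abbrev Idx := {p : SeqP × SeqP // G.RelPair p.1 p.2}

/-- The entry of a vector `v` indexed by relevant pairs at the pair `(σ₁, σ₂)`
(and `0` at irrelevant pairs, which never occur in the constraints below). -/
noncomputable def val (v : G.Idx → ℝ) (σ₁ σ₂ : SeqP) : ℝ :=
  if h : G.RelPair σ₁ σ₂ then v ⟨(σ₁, σ₂), h⟩ else 0

/-- The von Stengel–Forges polytope `𝒱`. -/
def VSF : Set (G.Idx → ℝ) :=
  {v | (∀ p, 0 ≤ v p) ∧
    G.val v none none = 1 ∧
    (∀ I₁, G.InfoSet 0 I₁ → ∀ σ₂, G.IsSeq 1 σ₂ → RelFor₁ σ₂ I₁ → ∀ u ∈ I₁,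
      ∑ a ∈ G.actions u, G.val v (some (I₁, a)) σ₂ = G.val v (G.parentSeq 0 I₁) σ₂) ∧
    (∀ I₂, G.InfoSet 1 I₂ → ∀ σ₁, G.IsSeq 0 σ₁ → RelFor₂ σ₁ I₂ → ∀ u ∈ I₂,
      ∑ a ∈ G.actions u, G.val v σ₁ (some (I₂, a)) = G.val v σ₁ (G.parentSeq 1 I₂))}

/-- `π` is a reduced-normal-form plan for player `i`. -/
def IsPlan (i : Fin 2) (π : PlanT) : Prop :=
  (∀ I, ¬ G.InfoSet i I → π I = none) ∧
  (∀ I, G.InfoSet i I →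
    ((π I).isSome = true ↔ ∀ u ∈ I, ∀ p ∈ G.playerSeq i u, π p.1 = some p.2)) ∧
  (∀ I a, G.InfoSet i I → π I = some a → ∃ u ∈ I, u ++ [a] ∈ G.H)

/-- `Πᵢ(σ)`: the set of reduced-normal-form plans of player `i` compatible with `σ`. -/
def PlanSet (i : Fin 2) : SeqP → Set PlanT
  | none => {π | G.IsPlan i π}
  | some (I, a) => {π | G.IsPlan i π ∧ π I = some a}

/-- `μ` is a probability distribution on `Π₁ × Π₂`. -/
def IsDist (μ : PlanT × PlanT → ℝ) : Prop :=
  (∀ q, 0 ≤ μ q) ∧ (Function.support μ).Finite ∧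
  (∀ q, μ q ≠ 0 → G.IsPlan 0 q.1 ∧ G.IsPlan 1 q.2) ∧
  ∑ᶠ q, μ q = 1

/-- The linear map `f` from distributions on `Π₁ × Π₂` to correlation plans. -/
noncomputable def corrMap (μ : PlanT × PlanT → ℝ) : G.Idx → ℝ :=
  fun p => ∑ᶠ q ∈ {q : PlanT × PlanT | q.1 ∈ G.PlanSet 0 p.1.1 ∧ q.2 ∈ G.PlanSet 1 p.1.2}, μ q

/-- The polytope of correlation plans `Ξ`: the image of the probability distributions
on `Π₁ × Π₂` under `f`. -/
def corrPoly : Set (G.Idx → ℝ) := {x | ∃ μ, G.IsDist μ ∧ x = G.corrMap μ}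

/-- The `σ₁`-rank of a player-2 information set `I₂`: the number of player-1
information sets connected to `I₂` whose parent sequence is `σ₁`. -/
noncomputable def rank₁ (σ₁ : SeqP) (I₂ : Set (List ℕ)) : ℕ :=
  Nat.card {J : Set (List ℕ) // G.InfoSet 0 J ∧ Connected J I₂ ∧ G.parentSeq 0 J = σ₁}

/-- The `σ₂`-rank of a player-1 information set `I₁`: the number of player-2
information sets connected to `I₁` whose parent sequence is `σ₂`. -/
noncomputable def rank₂ (σ₂ : SeqP) (I₁ : Set (List ℕ)) : ℕ :=
  Nat.card {J : Set (List ℕ) // G.InfoSet 1 J ∧ Connected I₁ J ∧ G.parentSeq 1 J = σ₂}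

end EFG

/-- The point-mass distribution `𝟙_{q₀}` on pairs of plans. -/
noncomputable def pointMass (q₀ : PlanT × PlanT) : PlanT × PlanT → ℝ :=
  fun q => if q = q₀ then 1 else 0

/-- The information sets of one player, ordered by the parent relation: `parent I` is the last
sequence played before `I`, and `depth I` is the number of sequences played before `I`. -/
structure InfoForest (T : Type*) where
  carrier : Set T
  parent : T → Option (T × ℕ)
  depth : T → ℕ
  parent_mem : ∀ {I K c}, I ∈ carrier → parent I = some (K, c) → K ∈ carrier
  depth_of_none : ∀ {I}, I ∈ carrier → parent I = none → depth I = 0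
  depth_of_some : ∀ {I K c}, I ∈ carrier → parent I = some (K, c) → depth I = depth K + 1

namespace InfoForest

variable {T : Type*}

/-- The sequence `σ` is played by the partial assignment `f` of actions. -/
def Reached (f : T → Option ℕ) (σ : Option (T × ℕ)) : Prop :=
  ∀ I a, σ = some (I, a) → f I = some a

/-- `f` assigns actions only to information sets whose parent sequence is played by `f`. -/
structure IsPartialPlan (F : InfoForest T) (f : T → Option ℕ) : Prop where
  mem : ∀ {I a}, f I = some a → I ∈ F.carrier
  reached : ∀ {I a}, f I = some a → Reached f (F.parent I)

/-- `I` is reached by `f` but has no action yet. -/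
structure Frontier (F : InfoForest T) (f : T → Option ℕ) (I : T) : Prop where
  mem : I ∈ F.carrier
  unassigned : f I = none
  reached : Reached f (F.parent I)

/-- `Q` passes from an information set to its ancestors. -/
def UpClosed (F : InfoForest T) (Q : T → Prop) : Prop :=
  ∀ ⦃I K c⦄, I ∈ F.carrier → F.parent I = some (K, c) → Q I → Q K

/-- Distinct assigned information sets satisfying `C` have distinct parent sequences. -/
def Thin (F : InfoForest T) (f : T → Option ℕ) (C : T → Prop) : Prop :=
  ∀ ⦃K K' a a'⦄, f K = some a → f K' = some a' → C K → C K' → F.parent K = F.parent K' → K = K'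

variable {F : InfoForest T} {f : T → Option ℕ} {C : T → Prop}

theorem Thin.parent_eq (hf : F.IsPartialPlan f) (hC : F.UpClosed C) (ht : F.Thin f C)
    {I I' : T} (hI : I ∈ F.carrier) (hI' : I' ∈ F.carrier) (hr : Reached f (F.parent I))
    (hr' : Reached f (F.parent I')) (hCI : C I) (hCI' : C I') (hd : F.depth I = F.depth I') :
    F.parent I = F.parent I' := by
  induction hn : F.depth I generalizing I I' with
  | zero =>
    cases hp : F.parent I with
    | some q => have := F.depth_of_some (c := q.2) hI hp; omega
    | none =>
      cases hp' : F.parent I' with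
      | some q => have := F.depth_of_some (c := q.2) hI' hp'; omega
      | none => rfl
  | succ n ih =>
    cases hp : F.parent I with
    | none => have := F.depth_of_none hI hp; omega
    | some q =>
      cases hp' : F.parent I' with
      | none => have := F.depth_of_none hI' hp'; omega
      | some q' =>
        obtain ⟨K, c⟩ := q
        obtain ⟨K', c'⟩ := q'
        have hd₁ := F.depth_of_some hI hp
        have hd₂ := F.depth_of_some hI' hp'
        have hK := hr K c hp
        have hK' := hr' K' c' hp'
        have hCK := hC hI hp hCI
        have hCK' := hC hI' hp' hCI'
        have hKK : K = K' := ht hK hK' hCK hCK' <|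
          ih (hf.mem hK) (hf.mem hK') (hf.reached hK) (hf.reached hK') hCK hCK'
            (by omega) (by omega)
        subst hKK
        rw [hK] at hK'
        rw [Option.some.inj hK']

theorem exists_ancestor (hf : F.IsPartialPlan f) {I : T} (hI : I ∈ F.carrier)
    (hr : Reached f (F.parent I)) {k : ℕ} (hk : k < F.depth I) :
    ∃ K a, f K = some a ∧ F.depth K = k ∧ ∀ Q : T → Prop, F.UpClosed Q → Q I → Q K := by
  induction hn : F.depth I generalizing I with
  | zero => omega
  | succ n ih =>
    cases hp : F.parent I with
    | none => have := F.depth_of_none hI hp; omega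
    | some q =>
      obtain ⟨K, c⟩ := q
      have hK := hr K c hp
      have hd := F.depth_of_some hI hp
      rcases Nat.lt_or_ge k (F.depth K) with h | h
      · obtain ⟨M, a, hM, hMk, hQ⟩ := ih (hf.mem hK) (hf.reached hK) h (by omega)
        exact ⟨M, a, hM, hMk, fun Q hQu hQI => hQ Q hQu (hQu hI hp hQI)⟩
      · exact ⟨K, c, hK, by omega, fun Q hQu hQI => hQu hI hp hQI⟩

theorem Thin.of_depth_le (hf : F.IsPartialPlan f) (hC : F.UpClosed C) (ht : F.Thin f C)
    {L L' : T} {b b' : ℕ} (hL : f L = some b) (hL' : f L' = some b') (hCL : C L) (hCL' : C L')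
    (hd : F.depth L' ≤ F.depth L) {Q : T → Prop} (hQ : F.UpClosed Q) (hQL : Q L) : Q L' := by
  have key : ∀ {K a}, f K = some a → C K → F.depth K = F.depth L' → K = L' :=
    fun hK hCK hKd => ht hK hL' hCK hCL' <|
      ht.parent_eq hf hC (hf.mem hK) (hf.mem hL') (hf.reached hK) (hf.reached hL') hCK hCL' hKd
  rcases hd.eq_or_lt with h | h
  · exact key hL hCL h.symm ▸ hQL
  · obtain ⟨K, a, hK, hKd, hKQ⟩ := exists_ancestor hf (hf.mem hL) (hf.reached hL) h
    exact key hK (hKQ C hC hCL) hKd ▸ hKQ Q hQ hQL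

end InfoForest

open InfoForest

/-- Two sequences are related when their information sets are connected. -/
def SeqRel {T : Type*} (conn : T → T → Prop) (σ₁ σ₂ : Option (T × ℕ)) : Prop :=
  ∀ I a J b, σ₁ = some (I, a) → σ₂ = some (J, b) → conn I J

/-- A triangle-free pair of forests, with a set `S` of sequence pairs that behaves like the support
of a point of the von Stengel–Forges polytope. -/
structure SupportSystem {T : Type*} (F₁ F₂ : InfoForest T) (conn : T → T → Prop)
    (S : Option (T × ℕ) → Option (T × ℕ) → Prop) : Prop where
  conn_left : ∀ J, F₁.UpClosed (conn · J)
  conn_right : ∀ I, F₂.UpClosed (conn I)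
  triangle_free : ∀ {I I' J J'}, I ∈ F₁.carrier → I' ∈ F₁.carrier → J ∈ F₂.carrier →
    J' ∈ F₂.carrier → I ≠ I' → J ≠ J' → F₁.parent I = F₁.parent I' →
    F₂.parent J = F₂.parent J' → conn I J → conn I' J' → conn I J' → False
  root : S none none
  up_left : ∀ {I a σ}, I ∈ F₁.carrier → S (some (I, a)) σ → S (F₁.parent I) σ
  up_right : ∀ {J b σ}, J ∈ F₂.carrier → S σ (some (J, b)) → S σ (F₂.parent J)
  down_left : ∀ {I σ}, I ∈ F₁.carrier → S (F₁.parent I) σ →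
    (∀ J b, σ = some (J, b) → conn I J) → ∃ a, S (some (I, a)) σ
  down_right : ∀ {J σ}, J ∈ F₂.carrier → S σ (F₂.parent J) →
    (∀ I a, σ = some (I, a) → conn I J) → ∃ b, S σ (some (J, b))

/-- A pair of partial plans all of whose played related sequence pairs lie in `S`, such that the
played sequences connected to an information set on the frontier form a chain. -/
structure PlanState {T : Type*} (F₁ F₂ : InfoForest T) (conn : T → T → Prop)
    (S : Option (T × ℕ) → Option (T × ℕ) → Prop) (f₁ f₂ : T → Option ℕ) : Prop where
  plan₁ : F₁.IsPartialPlan f₁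
  plan₂ : F₂.IsPartialPlan f₂
  thin₁ : ∀ {J}, F₂.Frontier f₂ J → F₁.Thin f₁ (conn · J)
  thin₂ : ∀ {I}, F₁.Frontier f₁ I → F₂.Thin f₂ (conn I)
  supp : ∀ {σ₁ σ₂}, Reached f₁ σ₁ → Reached f₂ σ₂ → SeqRel conn σ₁ σ₂ → S σ₁ σ₂

/-- Assigning an action to `I` would give two played sequences with a common parent that are
connected to the same frontier information set. -/
def Blocked {T : Type*} (F₁ F₂ : InfoForest T) (conn : T → T → Prop) (f₁ f₂ : T → Option ℕ)
    (I : T) : Prop :=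
  ∃ J K a, F₂.Frontier f₂ J ∧ conn I J ∧ f₁ K = some a ∧ F₁.parent K = F₁.parent I ∧ conn K J

section

variable {T : Type*} {F₁ F₂ : InfoForest T} {conn : T → T → Prop}
  {S : Option (T × ℕ) → Option (T × ℕ) → Prop} {f₁ f₂ : T → Option ℕ}

theorem SupportSystem.swap (h : SupportSystem F₁ F₂ conn S) :
    SupportSystem F₂ F₁ (fun J I => conn I J) (fun τ σ => S σ τ) where
  conn_left := h.conn_right
  conn_right := h.conn_left
  triangle_free hI hI' hJ hJ' hne hne' hp hp' h₁ h₂ h₃ :=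
    h.triangle_free hJ' hJ hI' hI hne'.symm hne.symm hp'.symm hp.symm h₂ h₁ h₃
  root := h.root
  up_left := h.up_right
  up_right := h.up_left
  down_left := h.down_right
  down_right := h.down_left

theorem PlanState.swap (h : PlanState F₁ F₂ conn S f₁ f₂) :
    PlanState F₂ F₁ (fun J I => conn I J) (fun τ σ => S σ τ) f₂ f₁ where
  plan₁ := h.plan₂
  plan₂ := h.plan₁
  thin₁ := h.thin₂
  thin₂ := h.thin₁
  supp h₁ h₂ hrel := h.supp h₂ h₁ fun I a J b hI hJ => hrel J b I a hJ hI

/-- An information set that blocks another one is not itself blocked. -/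
theorem SupportSystem.not_blocked (hS : SupportSystem F₁ F₂ conn S)
    (h : PlanState F₁ F₂ conn S f₁ f₂) {I J K : T} {a : ℕ} (hI : F₁.Frontier f₁ I)
    (hJ : F₂.Frontier f₂ J) (hIJ : conn I J) (hK : f₁ K = some a)
    (hKI : F₁.parent K = F₁.parent I) (hKJ : conn K J) :
    ¬ Blocked F₂ F₁ (fun J I => conn I J) f₂ f₁ J := by
  rintro ⟨I', L, b, hI', hI'J, hL, hLJ, hI'L⟩
  have ne₁ : ∀ {A B c}, f₁ A = some c → F₁.Frontier f₁ B → A ≠ B := by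
    rintro A B c hA hB rfl
    simp [hB.unassigned] at hA
  have hLneJ : L ≠ J := by
    rintro rfl
    simp [hJ.unassigned] at hL
  have hKm := h.plan₁.mem hK
  have hLm := h.plan₂.mem hL
  have hcl := hS.conn_left J
  have hthin := h.thin₁ hJ
  have hKd : F₁.depth K = F₁.depth I := by
    cases hp : F₁.parent I with
    | none => rw [F₁.depth_of_none hI.mem hp, F₁.depth_of_none hKm (hKI.trans hp)]
    | some q => rw [F₁.depth_of_some (c := q.2) hI.mem hp,
        F₁.depth_of_some (c := q.2) hKm (hKI.trans hp)]
  rcases lt_trichotomy (F₁.depth I') (F₁.depth I) with hd | hd | hd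
  · obtain ⟨K', a', hK', hK'd, hQ⟩ := exists_ancestor h.plan₁ hI.mem hI.reached hd
    have hK'J := hQ _ hcl hIJ
    have hp := hthin.parent_eq h.plan₁ hcl hI'.mem (h.plan₁.mem hK') hI'.reached
      (h.plan₁.reached hK') hI'J hK'J hK'd.symm
    exact hS.triangle_free hI'.mem (h.plan₁.mem hK') hLm hJ.mem (ne₁ hK' hI').symm hLneJ hp hLJ
      hI'L hK'J hI'J
  · have hp := hthin.parent_eq h.plan₁ hcl hI'.mem hI.mem hI'.reached hI.reached hI'J hIJ hd
    exact hS.triangle_free hI'.mem hKm hLm hJ.mem (ne₁ hK hI').symm hLneJ (hp.trans hKI.symm) hLJ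
      hI'L hKJ hI'J
  · obtain ⟨K', a', hK', hK'd, hQ⟩ := exists_ancestor h.plan₁ hI'.mem hI'.reached hd
    have hK'J := hQ _ hcl hI'J
    have hp := hthin.parent_eq h.plan₁ hcl (h.plan₁.mem hK') hKm (h.plan₁.reached hK')
      (h.plan₁.reached hK) hK'J hKJ (hK'd.trans hKd.symm)
    obtain rfl := hthin hK' hK hK'J hKJ hp
    exact hS.triangle_free hKm hI.mem hLm hJ.mem (ne₁ hK hI) hLneJ hKI hLJ
      (hQ _ (hS.conn_left L) hI'L) hIJ hKJ

theorem SeqRel.parent_left (hcl : ∀ J, F₁.UpClosed (conn · J)) {I : T} (hI : I ∈ F₁.carrier)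
    {σ : Option (T × ℕ)} (h : ∀ J b, σ = some (J, b) → conn I J) :
    SeqRel conn (F₁.parent I) σ :=
  fun _ _ J b hK hJ => hcl J hI hK (h J b hJ)

/-- Some action at a frontier information set is compatible with all sequences played by the
opponent. -/
theorem SupportSystem.exists_action (hS : SupportSystem F₁ F₂ conn S)
    (h : PlanState F₁ F₂ conn S f₁ f₂) (hfin : F₂.carrier.Finite) {I : T}
    (hI : F₁.Frontier f₁ I) :
    ∃ a, S (some (I, a)) none ∧ ∀ L b, f₂ L = some b → conn I L → S (some (I, a)) (some (L, b)) := by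
  have hrel : ∀ {σ}, Reached f₂ σ → (∀ J b, σ = some (J, b) → conn I J) →
      ∃ a, S (some (I, a)) σ := fun {σ} hσ hc =>
    hS.down_left hI.mem (h.supp hI.reached hσ (.parent_left hS.conn_left hI.mem hc)) hc
  by_cases hne : {L | ∃ b, f₂ L = some b ∧ conn I L}.Nonempty
  · have hfin' : {L | ∃ b, f₂ L = some b ∧ conn I L}.Finite :=
      hfin.subset fun L ⟨b, hb, _⟩ => h.plan₂.mem hb
    obtain ⟨L, ⟨b, hL, hIL⟩, hmax⟩ := Set.exists_max_image _ F₂.depth hfin' hne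
    obtain ⟨a, ha⟩ := hrel (σ := some (L, b)) (by rintro _ _ ⟨⟩; exact hL)
      (by rintro _ _ ⟨⟩; exact hIL)
    have hup : F₂.UpClosed fun M => ∃ c, f₂ M = some c ∧ S (some (I, a)) (some (M, c)) := by
      rintro M N c hM hp ⟨d, hd, hSd⟩
      exact ⟨c, h.plan₂.reached hd N c hp, hp ▸ hS.up_right hM hSd⟩
    have hall : ∀ L' b', f₂ L' = some b' → conn I L' → S (some (I, a)) (some (L', b')) := by
      intro L' b' hL' hIL'
      obtain ⟨c, hc, hSc⟩ := (h.thin₂ hI).of_depth_le h.plan₂ (hS.conn_right I) hL hL' hIL hIL'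
        (hmax L' ⟨b', hL', hIL'⟩) hup ⟨b, hL, ha⟩
      rw [hL'] at hc
      rwa [Option.some.inj hc]
    have hroot : ∀ n M c, F₂.depth M = n → f₂ M = some c → S (some (I, a)) (some (M, c)) →
        S (some (I, a)) none := by
      intro n
      induction n with
      | zero =>
        intro M c hd hM hSM
        have := hS.up_right (h.plan₂.mem hM) hSM
        cases hp : F₂.parent M with
        | none => rwa [hp] at this
        | some q => have := F₂.depth_of_some (c := q.2) (h.plan₂.mem hM) hp; omega
      | succ n ih =>
        intro M c hd hM hSM
        have hSp := hS.up_right (h.plan₂.mem hM) hSM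
        cases hp : F₂.parent M with
        | none => rwa [hp] at hSp
        | some q =>
          have := F₂.depth_of_some (c := q.2) (h.plan₂.mem hM) hp
          exact ih q.1 q.2 (by omega) (h.plan₂.reached hM _ _ hp) (hp ▸ hSp)
    exact ⟨a, hroot _ L b rfl hL ha, hall⟩
  · obtain ⟨a, ha⟩ := hrel (σ := none) (by rintro _ _ ⟨⟩) (by rintro _ _ ⟨⟩)
    exact ⟨a, ha, fun L b hL hIL => (hne ⟨L, b, hL, hIL⟩).elim⟩

theorem SupportSystem.exists_update (hS : SupportSystem F₁ F₂ conn S)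
    (h : PlanState F₁ F₂ conn S f₁ f₂) (hfin : F₂.carrier.Finite) {I : T}
    (hI : F₁.Frontier f₁ I) (hb : ¬ Blocked F₁ F₂ conn f₁ f₂ I) :
    ∃ a, PlanState F₁ F₂ conn S (Function.update f₁ I (some a)) f₂ := by
  obtain ⟨a, hnone, hsome⟩ := hS.exists_action h hfin hI
  have hcase : ∀ {K c}, Function.update f₁ I (some a) K = some c →
      (K = I ∧ c = a) ∨ f₁ K = some c := by
    intro K c hK
    by_cases hKI : K = I
    · subst hKI
      simp only [Function.update_self, Option.some.injEq] at hK
      exact .inl ⟨rfl, hK.symm⟩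
    · exact .inr (by rwa [Function.update_of_ne hKI] at hK)
  have hmono : ∀ {K c}, f₁ K = some c → Function.update f₁ I (some a) K = some c := by
    intro K c hK
    rw [Function.update_of_ne _ _ _, hK]
    rintro rfl
    simp [hI.unassigned] at hK
  refine ⟨a, ⟨⟨?_, ?_⟩, h.plan₂, ?_, ?_, ?_⟩⟩
  · intro K c hK
    rcases hcase hK with ⟨rfl, -⟩ | hK
    · exact hI.mem
    · exact h.plan₁.mem hK
  · intro K c hK M d hM
    rcases hcase hK with ⟨rfl, -⟩ | hK
    · exact hmono (hI.reached M d hM)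
    · exact hmono (h.plan₁.reached hK M d hM)
  · intro J hJ K K' c c' hK hK' hKJ hK'J hp
    rcases hcase hK with ⟨rfl, -⟩ | hfK <;> rcases hcase hK' with ⟨rfl, -⟩ | hfK'
    · rfl
    · exact (hb ⟨J, K', c', hJ, hKJ, hfK', hp.symm, hK'J⟩).elim
    · exact (hb ⟨J, K, c, hJ, hK'J, hfK, hp, hKJ⟩).elim
    · exact h.thin₁ hJ hfK hfK' hKJ hK'J hp
  · intro I' hI' L L' b b' hL hL' hIL hIL' hp
    have hun : f₁ I' = none := by
      cases hf : f₁ I' with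
      | none => rfl
      | some c => simpa [hmono hf] using hI'.unassigned
    by_cases hr : Reached f₁ (F₁.parent I')
    · exact h.thin₂ ⟨hI'.mem, hun, hr⟩ hL hL' hIL hIL' hp
    · simp only [Reached, not_forall] at hr
      obtain ⟨M, d, hM, hMd⟩ := hr
      rcases hcase (hI'.reached M d hM) with ⟨rfl, -⟩ | hM'
      · exact h.thin₂ hI hL hL' (hS.conn_left L hI'.mem hM hIL) (hS.conn_left L' hI'.mem hM hIL') hp
      · exact (hMd hM').elim
  · rintro σ₁ σ₂ h₁ h₂ hrel
    by_cases hr : Reached f₁ σ₁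
    · exact h.supp hr h₂ hrel
    · simp only [Reached, not_forall] at hr
      obtain ⟨M, d, rfl, hMd⟩ := hr
      rcases hcase (h₁ M d rfl) with ⟨rfl, rfl⟩ | hM'
      · cases σ₂ with
        | none => exact hnone
        | some q => exact hsome _ _ (h₂ q.1 q.2 rfl) (hrel _ _ _ _ rfl rfl)
      · exact (hMd hM').elim

theorem ncard_unassigned_update_lt {F : InfoForest T} {f : T → Option ℕ} (hfin : F.carrier.Finite)
    {I : T} (hI : F.Frontier f I) (a : ℕ) :
    {K ∈ F.carrier | Function.update f I (some a) K = none}.ncard <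
      {K ∈ F.carrier | f K = none}.ncard := by
  refine Set.ncard_lt_ncard ⟨?_, fun hsub => ?_⟩ (hfin.subset fun K hK => hK.1)
  · rintro K ⟨hK, hn⟩
    refine ⟨hK, ?_⟩
    rwa [Function.update_of_ne] at hn
    rintro rfl
    simp at hn
  · simpa using (hsub ⟨hI.mem, hI.unassigned⟩).2

/-- A triangle-free support system contains the played sequence pairs of a pair of full plans. -/
theorem SupportSystem.exists_complete (hS : SupportSystem F₁ F₂ conn S)
    (hfin₁ : F₁.carrier.Finite) (hfin₂ : F₂.carrier.Finite) :
    ∃ f₁ f₂, PlanState F₁ F₂ conn S f₁ f₂ ∧ (∀ I, ¬ F₁.Frontier f₁ I) ∧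
      ∀ J, ¬ F₂.Frontier f₂ J := by
  suffices H : ∀ n f₁ f₂, PlanState F₁ F₂ conn S f₁ f₂ →
      {K ∈ F₁.carrier | f₁ K = none}.ncard + {K ∈ F₂.carrier | f₂ K = none}.ncard = n →
      ∃ f₁ f₂, PlanState F₁ F₂ conn S f₁ f₂ ∧ (∀ I, ¬ F₁.Frontier f₁ I) ∧
        ∀ J, ¬ F₂.Frontier f₂ J by
    refine H _ (fun _ => none) (fun _ => none) ⟨⟨?_, ?_⟩, ⟨?_, ?_⟩, ?_, ?_, ?_⟩ rfl
    · rintro _ _ ⟨⟩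
    · rintro _ _ ⟨⟩
    · rintro _ _ ⟨⟩
    · rintro _ _ ⟨⟩
    · rintro _ _ _ _ _ _ ⟨⟩
    · rintro _ _ _ _ _ _ ⟨⟩
    · rintro (_ | q) (_ | q') h₁ h₂ -
      · exact hS.root
      · cases h₂ q'.1 q'.2 rfl
      · cases h₁ q.1 q.2 rfl
      · cases h₁ q.1 q.2 rfl
  intro n
  induction n using Nat.strong_induction_on with
  | _ n ih =>
    intro f₁ f₂ h hn
    have left : ∀ I, F₁.Frontier f₁ I → ¬ Blocked F₁ F₂ conn f₁ f₂ I →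
        ∃ f₁ f₂, PlanState F₁ F₂ conn S f₁ f₂ ∧ (∀ I, ¬ F₁.Frontier f₁ I) ∧
          ∀ J, ¬ F₂.Frontier f₂ J := by
      intro I hI hb
      obtain ⟨a, ha⟩ := hS.exists_update h hfin₂ hI hb
      have := ncard_unassigned_update_lt hfin₁ hI a
      exact ih _ (by omega) _ _ ha rfl
    have right : ∀ J, F₂.Frontier f₂ J → ¬ Blocked F₂ F₁ (fun J I => conn I J) f₂ f₁ J →
        ∃ f₁ f₂, PlanState F₁ F₂ conn S f₁ f₂ ∧ (∀ I, ¬ F₁.Frontier f₁ I) ∧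
          ∀ J, ¬ F₂.Frontier f₂ J := by
      intro J hJ hb
      obtain ⟨b, hb⟩ := hS.swap.exists_update h.swap hfin₁ hJ hb
      have := ncard_unassigned_update_lt hfin₂ hJ b
      exact ih _ (by omega) _ _ hb.swap rfl
    by_cases h₁ : ∃ I, F₁.Frontier f₁ I
    · obtain ⟨I, hI⟩ := h₁
      by_cases hb : Blocked F₁ F₂ conn f₁ f₂ I
      · obtain ⟨J, K, a, hJ, hIJ, hK, hKI, hKJ⟩ := hb
        exact right J hJ (hS.not_blocked h hI hJ hIJ hK hKI hKJ)
      · exact left I hI hb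
    · by_cases h₂ : ∃ J, F₂.Frontier f₂ J
      · obtain ⟨J, hJ⟩ := h₂
        refine right J hJ ?_
        rintro ⟨I, -, -, hI, -⟩
        exact h₁ ⟨I, hI⟩
      · exact ⟨f₁, f₂, h, fun I hI => h₁ ⟨I, hI⟩, fun J hJ => h₂ ⟨J, hJ⟩⟩

end

theorem Connected.symm {I J : Set (List ℕ)} : Connected I J → Connected J I
  | ⟨u, hu, v, hv, h⟩ => ⟨v, hv, u, hu, h.symm⟩

namespace EFG

variable {G : EFG} {i : Fin 2} {I J K : Set (List ℕ)} {u v : List ℕ} {a c : ℕ}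

theorem mem_actions : a ∈ G.actions u ↔ u ++ [a] ∈ G.H := by
  simp [actions]

theorem InfoSet.sim (hI : G.InfoSet i I) (hu : u ∈ I) (hv : v ∈ I) : G.sim i u v := by
  obtain ⟨w, -, rfl⟩ := hI
  exact G.sim_trans _ _ _ _ (G.sim_symm _ _ _ hu) hv

theorem InfoSet.nonempty (hI : G.InfoSet i I) : ∃ u, u ∈ I := by
  obtain ⟨w, hw, rfl⟩ := hI
  exact ⟨w, hw⟩

theorem InfoSet.mem_H (hI : G.InfoSet i I) (hu : u ∈ I) : u ∈ G.H := by
  obtain ⟨⟨a, ha⟩, -⟩ := G.sim_mem _ _ _ (hI.sim hu hu)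
  exact G.prefix_closed _ _ (List.prefix_append u [a]) ha

theorem finite_infoSet (G : EFG) (i : Fin 2) : {I | G.InfoSet i I}.Finite :=
  G.H.finite_toSet.finite_subsets.subset fun _ hI _ hu => InfoSet.mem_H hI hu

theorem playerSeq_append_singleton (G : EFG) (i : Fin 2) (u : List ℕ) (a : ℕ) :
    G.playerSeq i (u ++ [a]) = G.playerSeq i u ++
      if G.Internal u ∧ G.owner u = Fin.castSucc i then [({v | G.sim i u v}, a)] else [] := by
  simp only [playerSeq, List.length_append, List.length_singleton, List.range_succ,
    List.filterMap_append]
  congr 1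
  · refine List.filterMap_congr fun k hk => ?_
    have hk := List.mem_range.1 hk
    rw [List.take_append_of_le_length hk.le, List.getD_append _ _ _ _ hk]
  · by_cases h : G.Internal u ∧ G.owner u = Fin.castSucc i <;> simp [h]

theorem exists_of_getLast?_playerSeq (h : (G.playerSeq i u).getLast? = some (K, c)) :
    ∃ w, G.sim i w w ∧ K = {v | G.sim i w v} ∧ w ++ [c] <+: u ∧
      G.playerSeq i u = G.playerSeq i w ++ [(K, c)] := by
  induction u using List.reverseRecOn with
  | nil => simp [playerSeq] at h
  | append_singleton u a ih =>
    rw [playerSeq_append_singleton] at h ⊢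
    split_ifs at h ⊢ with hu
    · simp only [List.getLast?_append, List.getLast?_singleton, Option.some_or,
        Option.some.injEq, Prod.mk.injEq] at h
      obtain ⟨rfl, rfl⟩ := h
      exact ⟨u, G.sim_refl _ _ hu.1 hu.2, rfl, List.prefix_rfl, rfl⟩
    · rw [List.append_nil] at h ⊢
      obtain ⟨w, h₁, h₂, h₃, h₄⟩ := ih h
      exact ⟨w, h₁, h₂, h₃.trans (List.prefix_append u [a]), h₄⟩

theorem parentSeq_eq (hpr : G.PerfectRecall) (hI : G.InfoSet i I) (hu : u ∈ I) :
    G.parentSeq i I = (G.playerSeq i u).getLast? := by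
  have h : ∃ u, u ∈ I := ⟨u, hu⟩
  rw [parentSeq, dif_pos h, hpr i _ _ (hI.sim h.choose_spec hu)]

theorem exists_of_parentSeq (hpr : G.PerfectRecall) (hI : G.InfoSet i I) (hu : u ∈ I)
    (h : G.parentSeq i I = some (K, c)) :
    ∃ w ∈ K, G.InfoSet i K ∧ w ++ [c] <+: u ∧ G.playerSeq i u = G.playerSeq i w ++ [(K, c)] := by
  rw [parentSeq_eq hpr hI hu] at h
  obtain ⟨w, h₁, rfl, h₃, h₄⟩ := exists_of_getLast?_playerSeq h
  exact ⟨w, h₁, ⟨w, h₁, rfl⟩, h₃, h₄⟩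

/-- The number of sequences of player `i` played before the information set `I`. -/
noncomputable def infoDepth (G : EFG) (i : Fin 2) (I : Set (List ℕ)) : ℕ :=
  if h : ∃ u, u ∈ I then (G.playerSeq i h.choose).length else 0

theorem infoDepth_eq (hpr : G.PerfectRecall) (hI : G.InfoSet i I) (hu : u ∈ I) :
    G.infoDepth i I = (G.playerSeq i u).length := by
  have h : ∃ u, u ∈ I := ⟨u, hu⟩
  rw [infoDepth, dif_pos h, hpr i _ _ (hI.sim h.choose_spec hu)]

/-- The forest of information sets of a player with perfect recall. -/
noncomputable def infoForest (hpr : G.PerfectRecall) (i : Fin 2) : InfoForest (Set (List ℕ)) where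
  carrier := {I | G.InfoSet i I}
  parent := G.parentSeq i
  depth := G.infoDepth i
  parent_mem hI hp := by
    obtain ⟨u, hu⟩ := InfoSet.nonempty hI
    obtain ⟨w, -, hK, -⟩ := exists_of_parentSeq hpr hI hu hp
    exact hK
  depth_of_none hI hp := by
    obtain ⟨u, hu⟩ := InfoSet.nonempty hI
    rw [parentSeq_eq hpr hI hu, List.getLast?_eq_none_iff] at hp
    rw [infoDepth_eq hpr hI hu, hp, List.length_nil]
  depth_of_some hI hp := by
    obtain ⟨u, hu⟩ := InfoSet.nonempty hI
    obtain ⟨w, hw, hK, -, h⟩ := exists_of_parentSeq hpr hI hu hp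
    rw [infoDepth_eq hpr hI hu, infoDepth_eq hpr hK hw, h, List.length_append,
      List.length_singleton]

theorem Connected.of_parentSeq (hpr : G.PerfectRecall) (hI : G.InfoSet i I)
    (hp : G.parentSeq i I = some (K, c)) : Connected I J → Connected K J := by
  rintro ⟨u, hu, v, hv, h⟩
  obtain ⟨w, hw, -, hwu, -⟩ := exists_of_parentSeq hpr hI hu hp
  have hwu := (List.prefix_append w [c]).trans hwu
  exact ⟨w, hw, v, hv, h.elim (fun h => .inl (hwu.trans h))
    fun h => List.prefix_or_prefix_of_prefix hwu h⟩

theorem isSeq_parentSeq (hpr : G.PerfectRecall) (hI : G.InfoSet i I) :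
    G.IsSeq i (G.parentSeq i I) := by
  cases hp : G.parentSeq i I with
  | none => exact .inl rfl
  | some q =>
    obtain ⟨u, hu⟩ := hI.nonempty
    obtain ⟨w, hw, hK, hwu, -⟩ := exists_of_parentSeq hpr hI hu hp
    exact .inr ⟨q.1, q.2, rfl, hK, w, hw, G.prefix_closed _ _ hwu (hI.mem_H hu)⟩

theorem isSeq_some_iff {q : Set (List ℕ) × ℕ} (hu : u ∈ q.1) :
    G.IsSeq i (some q) ↔ G.InfoSet i q.1 ∧ q.2 ∈ G.actions u := by
  rw [mem_actions]
  constructor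
  · rintro (h | ⟨I, a, h, hI, w, hw, ha⟩)
    · cases h
    · cases h
      exact ⟨hI, (G.sim_actions _ _ _ (hI.sim hw hu) a).1 ha⟩
  · exact fun h => .inr ⟨q.1, q.2, rfl, h.1, u, hu, h.2⟩

theorem relPair_iff {σ₁ σ₂ : SeqP} :
    G.RelPair σ₁ σ₂ ↔ G.IsSeq 0 σ₁ ∧ G.IsSeq 1 σ₂ ∧ SeqRel Connected σ₁ σ₂ := by
  rw [RelPair, SeqRel]
  rcases σ₁ with _ | ⟨I, a⟩ <;> rcases σ₂ with _ | ⟨J, b⟩ <;> simp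
  exact fun _ _ => ⟨by rintro h _ _ _ _ rfl rfl rfl rfl; exact h,
    fun h => h _ _ _ _ rfl rfl rfl rfl⟩

theorem relFor₁_iff {σ : SeqP} : RelFor₁ σ I ↔ ∀ J b, σ = some (J, b) → Connected I J := by
  rcases σ with _ | ⟨J, b⟩ <;> simp [RelFor₁]

theorem relFor₂_iff {σ : SeqP} : RelFor₂ σ J ↔ ∀ I a, σ = some (I, a) → Connected I J := by
  rcases σ with _ | ⟨I, a⟩ <;> simp [RelFor₂]

theorem val_of_relPair (x : G.Idx → ℝ) {σ₁ σ₂ : SeqP} (h : G.RelPair σ₁ σ₂) :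
    G.val x σ₁ σ₂ = x ⟨(σ₁, σ₂), h⟩ := dif_pos h

theorem relPair_of_val_ne_zero {x : G.Idx → ℝ} {σ₁ σ₂ : SeqP} (h : G.val x σ₁ σ₂ ≠ 0) :
    G.RelPair σ₁ σ₂ := by
  by_contra hn
  exact h (dif_neg hn)

theorem val_nonneg {x : G.Idx → ℝ} (hx : ∀ p, 0 ≤ x p) (σ₁ σ₂ : SeqP) : 0 ≤ G.val x σ₁ σ₂ := by
  rw [val]
  split_ifs
  exacts [hx _, le_rfl]

/-- The support of a point of the von Stengel–Forges polytope of a triangle-free game. -/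
theorem supportSystem (hpr : G.PerfectRecall) (htf : G.TriangleFree) {x : G.Idx → ℝ}
    (hx : x ∈ G.VSF) :
    SupportSystem (infoForest hpr 0) (infoForest hpr 1) Connected
      fun σ₁ σ₂ => G.val x σ₁ σ₂ ≠ 0 where
  conn_left J I K c hI hp := Connected.of_parentSeq hpr hI hp
  conn_right I J K c hJ hp hIJ := (Connected.of_parentSeq hpr hJ hp hIJ.symm).symm
  triangle_free hI hI' hJ hJ' hne hne' hp hp' h₁ h₂ h₃ :=
    htf ⟨_, _, _, _, hI, hI', hJ, hJ', hne, hne', hp, hp', h₁, h₂, h₃⟩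
  root := by rw [hx.2.1]; exact one_ne_zero
  up_left {I a σ} hI h hz := by
    have hrel := relPair_iff.1 (relPair_of_val_ne_zero h)
    obtain ⟨u, hu⟩ := InfoSet.nonempty hI
    have hsum := hx.2.2.1 I hI σ hrel.2.1
      (relFor₁_iff.2 fun J b hJ => hrel.2.2 _ _ _ _ rfl hJ) u hu
    refine h ((Finset.sum_eq_zero_iff_of_nonneg fun b _ => val_nonneg hx.1 _ _).1
      (hsum.trans hz) a ((isSeq_some_iff hu).1 hrel.1).2)
  up_right {J b σ} hJ h hz := by
    have hrel := relPair_iff.1 (relPair_of_val_ne_zero h)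
    obtain ⟨u, hu⟩ := InfoSet.nonempty hJ
    have hsum := hx.2.2.2 J hJ σ hrel.1
      (relFor₂_iff.2 fun I a hI => hrel.2.2 _ _ _ _ hI rfl) u hu
    refine h ((Finset.sum_eq_zero_iff_of_nonneg fun b _ => val_nonneg hx.1 _ _).1
      (hsum.trans hz) b ((isSeq_some_iff hu).1 hrel.2.1).2)
  down_left {I σ} hI h hc := by
    obtain ⟨u, hu⟩ := InfoSet.nonempty hI
    have hsum := hx.2.2.1 I hI σ (relPair_of_val_ne_zero h).2.1 (relFor₁_iff.2 hc) u hu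
    obtain ⟨a, -, ha⟩ := Finset.exists_ne_zero_of_sum_ne_zero (hsum.trans_ne h)
    exact ⟨a, ha⟩
  down_right {J σ} hJ h hc := by
    obtain ⟨u, hu⟩ := InfoSet.nonempty hJ
    have hsum := hx.2.2.2 J hJ σ (relPair_of_val_ne_zero h).1 (relFor₂_iff.2 hc) u hu
    obtain ⟨b, -, hb⟩ := Finset.exists_ne_zero_of_sum_ne_zero (hsum.trans_ne h)
    exact ⟨b, hb⟩

/-- The correlation plan of a pair of deterministic plans. -/
noncomputable def pureCorr (G : EFG) (f₁ f₂ : PlanT) : G.Idx → ℝ :=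
  fun p => if Reached f₁ p.1.1 ∧ Reached f₂ p.1.2 then 1 else 0

theorem reached_some_iff {f : PlanT} : Reached f (some (I, a)) ↔ f I = some a :=
  ⟨fun h => h I a rfl, by rintro h _ _ ⟨⟩; exact h⟩

theorem sum_reached {hpr : G.PerfectRecall} {f : PlanT} (hf : (infoForest hpr i).IsPartialPlan f)
    (hfr : ¬ (infoForest hpr i).Frontier f I) (hact : ∀ b, f I = some b → b ∈ G.actions u)
    (hI : G.InfoSet i I) (P : Prop) :
    ∑ a ∈ G.actions u, (if Reached f (some (I, a)) ∧ P then 1 else 0 : ℝ) =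
      if Reached f (G.parentSeq i I) ∧ P then 1 else 0 := by
  by_cases hP : P
  swap
  · simp [hP]
  simp only [hP, and_true, reached_some_iff]
  cases hfI : f I with
  | none =>
    have : ¬ Reached f (G.parentSeq i I) := fun hr => hfr ⟨hI, hfI, hr⟩
    simp [this]
  | some b =>
    have : Reached f (G.parentSeq i I) := hf.reached hfI
    simp [this, hact b hfI]

theorem pureCorr_mem_VSF (hpr : G.PerfectRecall) (htf : G.TriangleFree) {x : G.Idx → ℝ}
    (hx : x ∈ G.VSF) {f₁ f₂ : PlanT}
    (h : PlanState (infoForest hpr 0) (infoForest hpr 1) Connected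
      (fun σ₁ σ₂ => G.val x σ₁ σ₂ ≠ 0) f₁ f₂)
    (h₁ : ∀ I, ¬ (infoForest hpr 0).Frontier f₁ I) (h₂ : ∀ I, ¬ (infoForest hpr 1).Frontier f₂ I) :
    G.pureCorr f₁ f₂ ∈ G.VSF := by
  have hS := supportSystem hpr htf hx
  have hnone : ∀ f : PlanT, Reached f none := by rintro f _ _ ⟨⟩
  have hval : ∀ {σ₁ σ₂}, G.RelPair σ₁ σ₂ → G.val (G.pureCorr f₁ f₂) σ₁ σ₂ =
      if Reached f₁ σ₁ ∧ Reached f₂ σ₂ then 1 else 0 := fun hr => val_of_relPair _ hr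
  have hval' : ∀ {σ₁ σ₂}, G.RelPair σ₁ σ₂ → G.val (G.pureCorr f₁ f₂) σ₁ σ₂ =
      if Reached f₂ σ₂ ∧ Reached f₁ σ₁ then 1 else 0 := fun hr =>
    (hval hr).trans (if_congr and_comm rfl rfl)
  refine ⟨fun p => ?_, ?_, ?_, ?_⟩
  · rw [pureCorr]
    split_ifs <;> norm_num
  · rw [hval ⟨.inl rfl, .inl rfl, .inl rfl⟩, if_pos ⟨hnone _, hnone _⟩]
  · intro I hI σ hσ hc u hu
    rw [relFor₁_iff] at hc
    rw [hval (relPair_iff.2 ⟨isSeq_parentSeq hpr hI, hσ, .parent_left hS.conn_left hI hc⟩),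
      ← sum_reached h.plan₁ (h₁ I) _ hI]
    · refine Finset.sum_congr rfl fun a ha => hval (relPair_iff.2
        ⟨(isSeq_some_iff hu).2 ⟨hI, ha⟩, hσ, ?_⟩)
      rintro _ _ J b ⟨⟩ hJ
      exact hc J b hJ
    · intro b hb
      have := relPair_of_val_ne_zero (h.supp (reached_some_iff.2 hb) (hnone f₂)
        (by rintro _ _ _ _ _ ⟨⟩))
      exact ((isSeq_some_iff hu).1 this.1).2
  · intro J hJ σ hσ hc u hu
    rw [relFor₂_iff] at hc
    rw [hval' (relPair_iff.2 ⟨hσ, isSeq_parentSeq hpr hJ, fun I a K c hI hK =>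
        hS.conn_right I hJ hK (hc I a hI)⟩), ← sum_reached h.plan₂ (h₂ J) _ hJ]
    · refine Finset.sum_congr rfl fun b hb => hval' (relPair_iff.2
        ⟨hσ, (isSeq_some_iff hu).2 ⟨hJ, hb⟩, ?_⟩)
      rintro I a _ _ hI ⟨⟩
      exact hc I a hI
    · intro b hb
      have := relPair_of_val_ne_zero (h.supp (hnone f₁) (reached_some_iff.2 hb)
        (by rintro _ _ _ _ ⟨⟩))
      exact ((isSeq_some_iff hu).1 this.2.1).2

theorem finite_idx (G : EFG) : Finite G.Idx := by
  have hseq : ∀ i, {σ | G.IsSeq i σ}.Finite := fun i => by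
    refine (((G.finite_infoSet i).prod (G.H.biUnion fun u => G.actions u).finite_toSet).image
      some |>.insert none).subset ?_
    rintro σ (rfl | ⟨I, a, rfl, hI, u, hu, ha⟩)
    · exact .inl rfl
    · refine .inr ⟨(I, a), ⟨hI, ?_⟩, rfl⟩
      exact Finset.mem_biUnion.2 ⟨u, hI.mem_H hu, mem_actions.2 ha⟩
  exact (((hseq 0).prod (hseq 1)).subset fun p hp => ⟨hp.1, hp.2.1⟩ :
    {p : SeqP × SeqP | G.RelPair p.1 p.2}.Finite)

/-- An extreme point of the polytope equals any zero-one point whose support it contains. -/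
theorem eq_of_mem_extremePoints {x e : G.Idx → ℝ} (hx : x ∈ G.VSF.extremePoints ℝ)
    (he : e ∈ G.VSF) (h01 : ∀ p, e p = 0 ∨ e p = 1) (hsupp : ∀ p, e p ≠ 0 → x p ≠ 0) :
    e = x := by
  have := G.finite_idx
  have hx' := hx.1
  obtain ⟨ε, hε, hε1, hle⟩ : ∃ ε : ℝ, 0 < ε ∧ ε < 1 ∧ ∀ p, ε * e p ≤ x p := by
    have hev : ∀ p, ∀ᶠ ε in nhdsWithin (0 : ℝ) (Set.Ioi 0), ε * e p ≤ x p := by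
      intro p
      rcases h01 p with h | h
      · exact .of_forall fun ε => by simpa [h] using hx'.1 p
      · have hpos : 0 < x p := (hx'.1 p).lt_of_ne' (hsupp p (by simp [h]))
        filter_upwards [Ioo_mem_nhdsGT hpos] with ε hε
        simpa [h] using hε.2.le
    obtain ⟨ε, h₁, h₂⟩ := ((Filter.eventually_all.2 hev).and
      (Ioo_mem_nhdsGT (zero_lt_one (α := ℝ)))).exists
    exact ⟨ε, h₂.1, h₂.2, h₁⟩
  have hpos : 0 < 1 - ε := by linarith
  let y : G.Idx → ℝ := fun p => (1 - ε)⁻¹ * (x p - ε * e p)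
  have hval : ∀ σ₁ σ₂, G.val y σ₁ σ₂ = (1 - ε)⁻¹ * (G.val x σ₁ σ₂ - ε * G.val e σ₁ σ₂) := by
    intro σ₁ σ₂
    unfold val
    split_ifs <;> simp [y]
  have hy : y ∈ G.VSF := by
    refine ⟨fun p => mul_nonneg (inv_nonneg.2 hpos.le) (sub_nonneg.2 (hle p)), ?_, ?_, ?_⟩
    · rw [hval, hx'.2.1, he.2.1, mul_one, inv_mul_cancel₀ hpos.ne']
    · intro I hI σ hσ hc u hu
      simp only [hval, ← Finset.mul_sum, Finset.sum_sub_distrib]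
      rw [hx'.2.2.1 I hI σ hσ hc u hu, he.2.2.1 I hI σ hσ hc u hu]
    · intro I hI σ hσ hc u hu
      simp only [hval, ← Finset.mul_sum, Finset.sum_sub_distrib]
      rw [hx'.2.2.2 I hI σ hσ hc u hu, he.2.2.2 I hI σ hσ hc u hu]
  refine hx.2 he hy ⟨ε, 1 - ε, hε, hpos, by ring, ?_⟩
  ext p
  simp only [y, Pi.add_apply, Pi.smul_apply, smul_eq_mul]
  field_simp
  ring

end EFG

/-- In a two-player perfect-recall triangle-free extensive-form game,
every extreme point of the von Stengel–Forges polytope has all coordinates in `{0, 1}`. -/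
theorem VSF_extremePoints_zero_one (G : EFG) (hpr : G.PerfectRecall)
    (htf : G.TriangleFree) :
    ∀ v ∈ G.VSF.extremePoints ℝ, ∀ p : G.Idx, v p = 0 ∨ v p = 1 := by
  intro v hv p
  obtain ⟨f₁, f₂, h, h₁, h₂⟩ := (EFG.supportSystem hpr htf hv.1).exists_complete
    (G.finite_infoSet 0) (G.finite_infoSet 1)
  have h01 : ∀ p, G.pureCorr f₁ f₂ p = 0 ∨ G.pureCorr f₁ f₂ p = 1 := fun p =>
    (ite_eq_or_eq _ _ _).symm
  have hsupp : ∀ p, G.pureCorr f₁ f₂ p ≠ 0 → v p ≠ 0 := by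
    intro p hp
    have hr : Reached f₁ p.1.1 ∧ Reached f₂ p.1.2 := by
      by_contra hn
      exact hp (if_neg hn)
    have := h.supp hr.1 hr.2 (EFG.relPair_iff.1 p.2).2.2
    rwa [EFG.val_of_relPair v p.2] at this
  rw [← EFG.eq_of_mem_extremePoints hv (EFG.pureCorr_mem_VSF hpr htf hv.1 h h₁ h₂) h01 hsupp]
  exact h01 p
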